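/- Let Ω ⊆ ℝⁿ be an open bounded convex set, ρ₁, ..., ρ_m rotations in SO(n), and u : Ω → [0,∞) a bounded measurable function with u = 0 outside Ω. Define u_i(x) = u(ρ_i^{-1}x) on ρ_iΩ and let u^♯_{p,m} be the (p, (1/m,...,1/m))-convolution of u₁,...,u_m on Ω_m = (1/m)(ρ₁Ω + ... + ρ_mΩ). Then for every t ∈ [0, sup u], the superlevel set {x ∈ Ω_m : u^♯_{p,m}(x) ≥ t} contains (1/m)∑_{i=1}^m ρ_i{x ∈ Ω : u(x) ≥ t}, and consequently its Lebesgue measure is at least |{x ∈ Ω : u(x) ≥ t}|. -/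

import Mathlib

open Real MeasureTheory Pointwise

theorem volume_add_le_volume_add_of_isCompact {K L : Set ℝ} (hK : IsCompact K) (hL : IsCompact L)
    (hK0 : K.Nonempty) (hL0 : L.Nonempty) : volume K + volume L ≤ volume (K + L) := by
  obtain ⟨a, haK, ha⟩ := hK.exists_isGreatest hK0
  obtain ⟨b, hbL, hb⟩ := hL.exists_isLeast hL0
  have hsub : ((fun x => x + b) '' K) ∪ ((fun x => a + x) '' L) ⊆ K + L := by
    rintro _ (⟨x, hx, rfl⟩ | ⟨x, hx, rfl⟩)
    · exact Set.add_mem_add hx hbL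
    · exact Set.add_mem_add haK hx
  have hdisj : AEDisjoint volume ((fun x => x + b) '' K) ((fun x => a + x) '' L) := by
    refine measure_mono_null (t := {a + b}) ?_ (by simp)
    rintro _ ⟨⟨x, hx, rfl⟩, ⟨y, hy, hxy⟩⟩
    have h1 := ha hx
    have h2 := hb hy
    simp only at hxy ⊢
    exact le_antisymm (by linarith) (by linarith)
  have hLm : MeasurableSet ((fun x => a + x) '' L) :=
    (hL.image (continuous_const_add a)).measurableSet
  calc volume K + volume L
      = volume ((fun x => x + b) '' K) + volume ((fun x => a + x) '' L) := by
        simp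
    _ = volume (((fun x => x + b) '' K) ∪ ((fun x => a + x) '' L)) :=
        (measure_union₀ hLm.nullMeasurableSet hdisj).symm
    _ ≤ _ := measure_mono hsub

theorem MeasurableSet.measure_eq_iSup_isCompact_nonempty {A : Set ℝ} (hA : MeasurableSet A)
    (hA0 : A.Nonempty) :
    volume A = ⨆ K : Set ℝ, ⨆ _ : K ⊆ A ∧ IsCompact K ∧ K.Nonempty, volume K := by
  obtain ⟨a, ha⟩ := hA0
  refine le_antisymm ?_ (iSup₂_le fun K hK => measure_mono hK.1)
  rw [hA.measure_eq_iSup_isCompact]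
  refine iSup_le fun K => iSup_le fun hKA => iSup_le fun hK => ?_
  refine le_iSup₂_of_le (insert a K) ⟨Set.insert_subset ha hKA, hK.insert a,
    Set.insert_nonempty a K⟩ (measure_mono (Set.subset_insert a K))

/-- The one-dimensional Brunn–Minkowski inequality. -/
theorem volume_add_le_volume_add {A B : Set ℝ} (hA : MeasurableSet A) (hB : MeasurableSet B)
    (hA0 : A.Nonempty) (hB0 : B.Nonempty) : volume A + volume B ≤ volume (A + B) := by
  rw [hA.measure_eq_iSup_isCompact_nonempty hA0, hB.measure_eq_iSup_isCompact_nonempty hB0]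
  obtain ⟨a, ha⟩ := hA0
  obtain ⟨b, hb⟩ := hB0
  refine ENNReal.biSup_add_biSup_le' ⟨{a}, by simpa⟩ ⟨{b}, by simpa⟩ ?_
  rintro K ⟨hKA, hK, hK0⟩ L ⟨hLB, hL, hL0⟩
  exact (volume_add_le_volume_add_of_isCompact hK hL hK0 hL0).trans
    (measure_mono (Set.add_subset_add hKA hLB))

theorem volume_convex_combination_le {A B C : Set ℝ} (hA : MeasurableSet A) (hB : MeasurableSet B)
    (hA0 : A.Nonempty) (hB0 : B.Nonempty) {l : ℝ} (h0 : 0 < l) (h1 : l < 1)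
    (hC : ∀ x ∈ A, ∀ y ∈ B, l • x + (1 - l) • y ∈ C) :
    ENNReal.ofReal l * volume A + ENNReal.ofReal (1 - l) * volume B ≤ volume C := by
  have hl : 0 < 1 - l := by linarith
  have key := volume_add_le_volume_add (hA.const_smul₀ l) (hB.const_smul₀ (1 - l))
    (hA0.smul_set (a := l)) (hB0.smul_set (a := 1 - l))
  simp only [Measure.addHaar_smul, Module.finrank_self, pow_one, abs_of_pos h0, abs_of_pos hl]
    at key
  refine key.trans (measure_mono ?_)
  rintro _ ⟨_, ⟨x, hx, rfl⟩, _, ⟨y, hy, rfl⟩, rfl⟩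
  exact hC x hx y hy

theorem lintegral_eq_lintegral_meas_ofReal_lt {α : Type*} [MeasurableSpace α] (μ : Measure α)
    {f : α → ENNReal} (hf : Measurable f) (hf' : ∀ x, f x ≠ ⊤) :
    ∫⁻ x, f x ∂μ = ∫⁻ t in Set.Ioi (0 : ℝ), μ {x | ENNReal.ofReal t < f x} := by
  have h := lintegral_eq_lintegral_meas_lt μ (f := fun x => (f x).toReal)
    (Filter.Eventually.of_forall fun x => ENNReal.toReal_nonneg) hf.ennreal_toReal.aemeasurable
  simp only [ENNReal.ofReal_toReal (hf' _)] at h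
  rw [h]
  refine setLIntegral_congr_fun measurableSet_Ioi fun t ht => ?_
  simp only [ENNReal.ofReal_lt_iff_lt_toReal (le_of_lt ht) (hf' _)]

theorem ENNReal.geom_mean_le_arith_mean_two {l : ℝ} (h0 : 0 < l) (h1 : l < 1) (x y : ENNReal) :
    x ^ l * y ^ (1 - l) ≤ ENNReal.ofReal l * x + ENNReal.ofReal (1 - l) * y := by
  have hl : 0 < 1 - l := by linarith
  rcases eq_or_ne x ⊤ with rfl | hx
  · simp [ENNReal.mul_top, h0]
  rcases eq_or_ne y ⊤ with rfl | hy
  · simp [ENNReal.mul_top, h1]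
  lift x to NNReal using hx
  lift y to NNReal using hy
  have h := NNReal.geom_mean_le_arith_mean2_weighted l.toNNReal (1 - l).toNNReal x y
    (by rw [← Real.toNNReal_add h0.le hl.le]; simp)
  rw [Real.coe_toNNReal _ h0.le, Real.coe_toNNReal _ hl.le] at h
  rw [← ENNReal.coe_rpow_of_nonneg _ h0.le, ← ENNReal.coe_rpow_of_nonneg _ hl.le]
  simp only [ENNReal.ofReal]
  exact_mod_cast h

theorem ENNReal.min_le_geom_mean {l : ℝ} (h0 : 0 < l) (h1 : l < 1) (x y : ENNReal) :
    min x y ≤ x ^ l * y ^ (1 - l) := by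
  have hl : 0 < 1 - l := by linarith
  calc min x y = min x y ^ (l + (1 - l)) := by simp
    _ = min x y ^ l * min x y ^ (1 - l) := ENNReal.rpow_add_of_nonneg _ _ h0.le hl.le
    _ ≤ _ := by
      gcongr
      · exact min_le_left x y
      · exact min_le_right x y

/-- A measure satisfies the Prékopa–Leindler inequality. -/
def PrekopaLeindler {E : Type*} [AddCommGroup E] [Module ℝ E] [MeasurableSpace E]
    (μ : Measure E) : Prop :=
  ∀ l : ℝ, 0 < l → l < 1 → ∀ f g h : E → ENNReal, Measurable f → Measurable g → Measurable h →
    (∀ x y, f x ^ l * g y ^ (1 - l) ≤ h (l • x + (1 - l) • y)) →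
    (∫⁻ x, f x ∂μ) ^ l * (∫⁻ x, g x ∂μ) ^ (1 - l) ≤ ∫⁻ x, h x ∂μ

theorem lintegral_convex_combination_le_of_iSup_eq_one {l : ℝ} (h0 : 0 < l) (h1 : l < 1)
    {f g h : ℝ → ENNReal} (hf : Measurable f) (hg : Measurable g) (hh : Measurable h)
    (hf1 : ⨆ x, f x = 1) (hg1 : ⨆ x, g x = 1)
    (H : ∀ x y, min (f x) (g y) ≤ h (l • x + (1 - l) • y)) :
    ENNReal.ofReal l * (∫⁻ x, f x) + ENNReal.ofReal (1 - l) * (∫⁻ x, g x) ≤ ∫⁻ x, h x := by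
  have hfle : ∀ x, f x ≤ 1 := fun x => hf1 ▸ le_iSup f x
  have hgle : ∀ x, g x ≤ 1 := fun x => hg1 ▸ le_iSup g x
  have hmeas : ∀ f : ℝ → ENNReal, Measurable f →
      Measurable fun t : ℝ => volume {x | ENNReal.ofReal t < f x} := by
    intro f hf
    have : Antitone fun t : ℝ => volume {x | ENNReal.ofReal t < f x} := fun s t hst =>
      measure_mono fun x hx => lt_of_le_of_lt (ENNReal.ofReal_le_ofReal hst) hx
    exact this.measurable
  refine le_trans ?_ (lintegral_mono fun x => min_le_left (h x) 1)
  rw [lintegral_eq_lintegral_meas_ofReal_lt volume hf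
      fun x => ne_top_of_le_ne_top ENNReal.one_ne_top (hfle x),
    lintegral_eq_lintegral_meas_ofReal_lt volume hg
      fun x => ne_top_of_le_ne_top ENNReal.one_ne_top (hgle x),
    lintegral_eq_lintegral_meas_ofReal_lt volume (hh.min measurable_const)
      fun x => ne_top_of_le_ne_top ENNReal.one_ne_top (min_le_right _ _),
    ← lintegral_const_mul _ (hmeas f hf), ← lintegral_const_mul _ (hmeas g hg),
    ← lintegral_add_left ((hmeas f hf).const_mul _)]
  refine lintegral_mono fun t => ?_
  by_cases ht : ENNReal.ofReal t < 1
  · refine volume_convex_combination_le (measurableSet_lt measurable_const hf)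
      (measurableSet_lt measurable_const hg) (lt_iSup_iff.1 (ht.trans_eq hf1.symm))
      (lt_iSup_iff.1 (ht.trans_eq hg1.symm)) h0 h1 fun x hx y hy => ?_
    exact lt_min ((lt_min hx hy).trans_le (H x y)) ht
  · have he : ∀ f : ℝ → ENNReal, (∀ x, f x ≤ 1) → {x | ENNReal.ofReal t < f x} = ∅ := fun f hf =>
      Set.eq_empty_of_forall_notMem fun x hx => ht (lt_of_lt_of_le hx (hf x))
    simp [he f hfle, he g hgle]

theorem prekopaLeindler_real_of_bounded {l : ℝ} (h0 : 0 < l) (h1 : l < 1)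
    {f g h : ℝ → ENNReal} (hf : Measurable f) (hg : Measurable g) (hh : Measurable h)
    (hfb : ⨆ x, f x ≠ ⊤) (hgb : ⨆ x, g x ≠ ⊤)
    (H : ∀ x y, f x ^ l * g y ^ (1 - l) ≤ h (l • x + (1 - l) • y)) :
    (∫⁻ x, f x) ^ l * (∫⁻ x, g x) ^ (1 - l) ≤ ∫⁻ x, h x := by
  have hl : 0 < 1 - l := by linarith
  set a := ⨆ x, f x with ha
  set b := ⨆ x, g x with hb
  rcases eq_or_ne a 0 with ha0 | ha0
  · have : ∀ x, f x = 0 := by simpa [ha] using ha0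
    simp [this, h0]
  rcases eq_or_ne b 0 with hb0 | hb0
  · have : ∀ x, g x = 0 := by simpa [hb] using hb0
    simp [this, h1]
  set c := a ^ l * b ^ (1 - l) with hc
  have hc0 : c ≠ 0 := mul_ne_zero (by simp [ENNReal.rpow_eq_zero_iff, ha0, hfb])
    (by simp [ENNReal.rpow_eq_zero_iff, hb0, hgb])
  have hct : c ≠ ⊤ := ENNReal.mul_ne_top (ENNReal.rpow_ne_top_of_nonneg h0.le hfb)
    (ENNReal.rpow_ne_top_of_nonneg hl.le hgb)
  have hint : ∀ (k : ℝ → ENNReal) (d : ENNReal), Measurable k → d ≠ 0 → d ≠ ⊤ →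
      ∫⁻ x, k x = d * ∫⁻ x, d⁻¹ * k x := fun k d hk hd hd' => by
    rw [lintegral_const_mul _ hk, ← mul_assoc, ENNReal.mul_inv_cancel hd hd', one_mul]
  have key := lintegral_convex_combination_le_of_iSup_eq_one h0 h1 (hf.const_mul a⁻¹)
    (hg.const_mul b⁻¹) (hh.const_mul c⁻¹)
    (by rw [← ENNReal.mul_iSup, ← ha, ENNReal.inv_mul_cancel ha0 hfb])
    (by rw [← ENNReal.mul_iSup, ← hb, ENNReal.inv_mul_cancel hb0 hgb])
    (fun x y => by
      refine (ENNReal.min_le_geom_mean h0 h1 _ _).trans ?_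
      rw [ENNReal.mul_rpow_of_nonneg _ _ h0.le, ENNReal.mul_rpow_of_nonneg _ _ hl.le,
        mul_mul_mul_comm, ENNReal.inv_rpow, ENNReal.inv_rpow,
        ← ENNReal.mul_inv (Or.inr (ENNReal.rpow_ne_top_of_nonneg hl.le hgb))
          (Or.inl (ENNReal.rpow_ne_top_of_nonneg h0.le hfb))]
      gcongr
      exact H x y)
  rw [hint f a hf ha0 hfb, hint g b hg hb0 hgb, hint h c hh hc0 hct,
    ENNReal.mul_rpow_of_nonneg _ _ h0.le, ENNReal.mul_rpow_of_nonneg _ _ hl.le, mul_mul_mul_comm]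
  gcongr
  exact (ENNReal.geom_mean_le_arith_mean_two h0 h1 _ _).trans key

theorem tendsto_lintegral_min_natCast {α : Type*} [MeasurableSpace α] (μ : Measure α)
    {f : α → ENNReal} (hf : Measurable f) :
    Filter.Tendsto (fun N : ℕ => ∫⁻ x, min (f x) N ∂μ) Filter.atTop (nhds (∫⁻ x, f x ∂μ)) := by
  refine lintegral_tendsto_of_tendsto_of_monotone
    (fun N => (hf.min measurable_const).aemeasurable)
    (Filter.Eventually.of_forall fun x M N hMN => min_le_min le_rfl (by exact_mod_cast hMN))
    (Filter.Eventually.of_forall fun x => ?_)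
  simpa using (tendsto_const_nhds (x := f x)).min ENNReal.tendsto_nat_nhds_top

theorem prekopaLeindler_real : PrekopaLeindler (volume : Measure ℝ) := by
  intro l h0 h1 f g h hf hg hh H
  have hl : 0 < 1 - l := by linarith
  rcases eq_or_ne (∫⁻ x, f x) 0 with hf0 | hf0
  · simp [hf0, h0]
  rcases eq_or_ne (∫⁻ x, g x) 0 with hg0 | hg0
  · simp [hg0, h1]
  have hlim := ENNReal.Tendsto.mul
    ((tendsto_lintegral_min_natCast volume hf).ennrpow_const l)
    (Or.inl (by simp [ENNReal.rpow_eq_zero_iff, hf0, h0.not_gt]))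
    ((tendsto_lintegral_min_natCast volume hg).ennrpow_const (1 - l))
    (Or.inl (by simp [ENNReal.rpow_eq_zero_iff, hg0, h1.not_gt]))
  refine le_of_tendsto' hlim fun N => ?_
  have hb : ∀ f : ℝ → ENNReal, ⨆ x, min (f x) (N : ENNReal) ≠ ⊤ := fun f =>
    ne_top_of_le_ne_top (ENNReal.natCast_ne_top N) (iSup_le fun x => min_le_right _ _)
  refine prekopaLeindler_real_of_bounded h0 h1 (hf.min measurable_const)
    (hg.min measurable_const) hh (hb f) (hb g) fun x y => le_trans ?_ (H x y)
  gcongr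
  · exact min_le_left _ _
  · exact min_le_left _ _

namespace PrekopaLeindler

variable {E F : Type*} [AddCommGroup E] [Module ℝ E] [MeasurableSpace E]
  [AddCommGroup F] [Module ℝ F] [MeasurableSpace F] {μ : Measure E} {ν : Measure F}

theorem prod [SFinite μ] [SFinite ν] (hμ : PrekopaLeindler μ) (hν : PrekopaLeindler ν) :
    PrekopaLeindler (μ.prod ν) := by
  intro l h0 h1 f g h hf hg hh H
  rw [lintegral_prod _ hf.aemeasurable, lintegral_prod _ hg.aemeasurable,
    lintegral_prod _ hh.aemeasurable]
  refine hμ l h0 h1 _ _ _ hf.lintegral_prod_right' hg.lintegral_prod_right'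
    hh.lintegral_prod_right' fun x y => ?_
  exact hν l h0 h1 _ _ _ (hf.comp measurable_prodMk_left) (hg.comp measurable_prodMk_left)
    (hh.comp measurable_prodMk_left) fun v w => H (x, v) (y, w)

theorem of_measurePreserving (hμ : PrekopaLeindler μ) (e : E →ₗ[ℝ] F)
    (he : MeasurePreserving e μ ν) : PrekopaLeindler ν := by
  intro l h0 h1 f g h hf hg hh H
  rw [← he.lintegral_comp hf, ← he.lintegral_comp hg, ← he.lintegral_comp hh]
  refine hμ l h0 h1 _ _ _ (hf.comp he.measurable) (hg.comp he.measurable)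
    (hh.comp he.measurable) fun x y => ?_
  simpa using H (e x) (e y)

end PrekopaLeindler

theorem prekopaLeindler_pi (n : ℕ) : PrekopaLeindler (volume : Measure (Fin n → ℝ)) := by
  induction n with
  | zero =>
    intro l h0 h1 f g h _ _ _ H
    have hv : (volume : Measure (Fin 0 → ℝ)) = Measure.dirac 0 := Measure.volume_pi_eq_dirac 0
    simp only [hv, lintegral_dirac]
    exact (H _ _).trans_eq (congrArg h (Subsingleton.elim _ _))
  | succ n ih =>
    refine (prekopaLeindler_real.prod ih).of_measurePreserving
      (Fin.consLinearEquiv ℝ fun _ : Fin (n + 1) => ℝ).toLinearMap ?_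
    have he : ⇑(Fin.consLinearEquiv ℝ fun _ : Fin (n + 1) => ℝ).toLinearMap =
        (MeasurableEquiv.piFinSuccAbove (fun _ : Fin (n + 1) => ℝ) 0).symm := by
      ext x i
      simp [Fin.insertNthEquiv, Fin.consLinearEquiv, MeasurableEquiv.piFinSuccAbove]
    rw [he]
    exact (volume_preserving_piFinSuccAbove (fun _ : Fin (n + 1) => ℝ) 0).symm

theorem prekopaLeindler_euclideanSpace (n : ℕ) :
    PrekopaLeindler (volume : Measure (EuclideanSpace ℝ (Fin n))) :=
  (prekopaLeindler_pi n).of_measurePreserving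
    (WithLp.linearEquiv 2 ℝ (Fin n → ℝ)).symm.toLinearMap (PiLp.volume_preserving_toLp (Fin n))

/-- The Brunn–Minkowski inequality in multiplicative form, for sets of volume at least `V`. -/
theorem le_volume_convex_combination {n : ℕ} {A B : Set (EuclideanSpace ℝ (Fin n))}
    (hA : IsCompact A) (hB : IsCompact B) {V : ENNReal} (hVA : V ≤ volume A) (hVB : V ≤ volume B)
    {l : ℝ} (h0 : 0 < l) (h1 : l < 1) : V ≤ volume (l • A + (1 - l) • B) := by
  have hl : 0 < 1 - l := by linarith
  have hC : IsCompact (l • A + (1 - l) • B) := (hA.smul l).add (hB.smul (1 - l))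
  have key := prekopaLeindler_euclideanSpace n l h0 h1 (A.indicator 1) (B.indicator 1)
    ((l • A + (1 - l) • B).indicator 1) (measurable_one.indicator hA.measurableSet)
    (measurable_one.indicator hB.measurableSet) (measurable_one.indicator hC.measurableSet) ?_
  · rw [lintegral_indicator_one hA.measurableSet, lintegral_indicator_one hB.measurableSet,
      lintegral_indicator_one hC.measurableSet] at key
    calc V ≤ min (volume A) (volume B) := le_min hVA hVB
      _ ≤ _ := ENNReal.min_le_geom_mean h0 h1 _ _
      _ ≤ _ := key
  · intro x y
    by_cases hx : x ∈ A
    · by_cases hy : y ∈ B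
      · have := Set.add_mem_add (Set.smul_mem_smul_set (a := l) hx)
          (Set.smul_mem_smul_set (a := 1 - l) hy)
        simp [hx, hy, this]
      · simp [hy, h1]
    · simp [hx, h0]

theorem le_volume_mean_of_isCompact {n : ℕ} {ι : Type*} (s : Finset ι) (hs : s.Nonempty)
    (K : ι → Set (EuclideanSpace ℝ (Fin n))) (hK : ∀ i, IsCompact (K i)) {V : ENNReal}
    (hV : ∀ i, V ≤ volume (K i)) :
    IsCompact (∑ i ∈ s, K i) ∧ V ≤ volume (((1 : ℝ) / s.card) • ∑ i ∈ s, K i) := by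
  induction hs using Finset.Nonempty.cons_induction with
  | singleton i => simpa using ⟨hK i, hV i⟩
  | cons i s his hs ih =>
    have hk : (0 : ℝ) < s.card := by exact_mod_cast hs.card_pos
    rw [Finset.sum_cons, Finset.card_cons]
    refine ⟨(hK i).add ih.1, ?_⟩
    have h := le_volume_convex_combination (hK i) (ih.1.smul ((1 : ℝ) / s.card)) (hV i) ih.2
      (l := 1 / ((s.card + 1 : ℕ) : ℝ)) (by positivity)
      (by rw [div_lt_one (by positivity)]; push_cast; linarith)
    rwa [smul_smul, show (1 - 1 / ((s.card + 1 : ℕ) : ℝ)) * (1 / s.card) =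
      1 / ((s.card + 1 : ℕ) : ℝ) by push_cast; field_simp; ring, ← smul_add] at h

theorem volume_le_volume_mean_image {n m : ℕ} (hm : 1 ≤ m)
    (ρ : Fin m → (EuclideanSpace ℝ (Fin n) ≃ₗᵢ[ℝ] EuclideanSpace ℝ (Fin n)))
    {A : Set (EuclideanSpace ℝ (Fin n))} (hA : MeasurableSet A) :
    volume A ≤ volume (((1 : ℝ) / m) • ∑ i, (fun z => (ρ i) z) '' A) := by
  rw [hA.measure_eq_iSup_isCompact]
  refine iSup_le fun K => iSup_le fun hKA => iSup_le fun hK => ?_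
  have : Nonempty (Fin m) := ⟨⟨0, hm⟩⟩
  have h := (le_volume_mean_of_isCompact Finset.univ Finset.univ_nonempty
    (fun i => (fun z => (ρ i) z) '' K) (fun i => hK.image (ρ i).continuous)
    (V := volume K) fun i => ?_).2
  · rw [Finset.card_univ, Fintype.card_fin] at h
    exact h.trans (measure_mono (Set.smul_set_mono
      (Set.finsetSum_subset_finsetSum _ _ _ fun i _ => Set.image_mono hKA)))
  · rw [← (ρ i).measurePreserving.measure_preimage
      (hK.image (ρ i).continuous).nullMeasurableSet]
    exact measure_mono (Set.subset_preimage_image _ _)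

theorem one_div_mul_sum_rpow_le {m : ℕ} (hm : 1 ≤ m) {p : ℝ} (hp : 0 < p) {a : Fin m → ℝ} {c : ℝ}
    (ha0 : ∀ i, 0 ≤ a i) (hac : ∀ i, a i ≤ c) (hc : 0 ≤ c) :
    (∑ i, ((1 : ℝ) / m) * a i ^ p) ^ (1 / p) ≤ c := by
  have hm0 : (m : ℝ) ≠ 0 := by positivity
  calc (∑ i, ((1 : ℝ) / m) * a i ^ p) ^ (1 / p)
      ≤ (∑ _i : Fin m, ((1 : ℝ) / m) * c ^ p) ^ (1 / p) := by
        refine Real.rpow_le_rpow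
          (Finset.sum_nonneg fun i _ => mul_nonneg (by positivity) (Real.rpow_nonneg (ha0 i) p))
          (Finset.sum_le_sum fun i _ => ?_) (by positivity)
        gcongr
        · exact ha0 i
        · exact hac i
    _ = c := by
        rw [Finset.sum_const, Finset.card_univ, Fintype.card_fin, nsmul_eq_mul, ← mul_assoc,
          mul_one_div_cancel hm0, one_mul, ← Real.rpow_mul hc, mul_one_div_cancel hp.ne',
          Real.rpow_one]

theorem le_one_div_mul_sum_rpow {m : ℕ} (hm : 1 ≤ m) {p : ℝ} (hp : 0 < p) {a : Fin m → ℝ} {t : ℝ}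
    (ht : 0 ≤ t) (hta : ∀ i, t ≤ a i) :
    t ≤ (∑ i, ((1 : ℝ) / m) * a i ^ p) ^ (1 / p) := by
  have hm0 : (m : ℝ) ≠ 0 := by positivity
  calc t = (∑ _i : Fin m, ((1 : ℝ) / m) * t ^ p) ^ (1 / p) := by
        rw [Finset.sum_const, Finset.card_univ, Fintype.card_fin, nsmul_eq_mul, ← mul_assoc,
          mul_one_div_cancel hm0, one_mul, ← Real.rpow_mul ht, mul_one_div_cancel hp.ne',
          Real.rpow_one]
    _ ≤ _ := by
        gcongr with i
        exact hta i



theorem superlevel_of_rotation_mean_convolution {n m : ℕ} (hm : 1 ≤ m)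
    (Ω : Set (EuclideanSpace ℝ (Fin n)))
    (hΩo : IsOpen Ω) (hΩb : Bornology.IsBounded Ω) (hΩc : Convex ℝ Ω)
    (ρ : Fin m → (EuclideanSpace ℝ (Fin n) ≃ₗᵢ[ℝ] EuclideanSpace ℝ (Fin n)))
    (hdet : ∀ i, LinearMap.det ((ρ i).toLinearEquiv :
      EuclideanSpace ℝ (Fin n) →ₗ[ℝ] EuclideanSpace ℝ (Fin n)) = 1)
    (u : EuclideanSpace ℝ (Fin n) → ℝ)
    (hum : Measurable u) (hub : ∃ C, ∀ x, u x ≤ C)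
    (hun : ∀ x, 0 ≤ u x) (huz : ∀ x ∉ Ω, u x = 0)
    (p : ℝ) (hp : 0 < p)
    (usharp : EuclideanSpace ℝ (Fin n) → ℝ)
    (husharp : ∀ x, usharp x = sSup {mval : ℝ |
      ∃ y : Fin m → EuclideanSpace ℝ (Fin n),
        (∀ i, y i ∈ closure ((fun z => (ρ i) z) '' Ω)) ∧
        x = ∑ i, ((1 : ℝ) / m) • y i ∧
        mval = (∑ i, ((1 : ℝ) / m) * u ((ρ i).symm (y i)) ^ p) ^ (1 / p)})
    (t : ℝ) (ht0 : 0 ≤ t) (ht1 : t ≤ sSup (u '' Ω)) :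
    (((1 : ℝ) / m) • ∑ i, (fun z => (ρ i) z) '' {x ∈ Ω | t ≤ u x} ⊆
        {x ∈ ((1 : ℝ) / m) • ∑ i, (fun z => (ρ i) z) '' Ω | t ≤ usharp x}) ∧
      volume {x ∈ Ω | t ≤ u x} ≤
        volume {x ∈ ((1 : ℝ) / m) • ∑ i, (fun z => (ρ i) z) '' Ω | t ≤ usharp x} := by
  have hsub : ((1 : ℝ) / m) • ∑ i, (fun z => (ρ i) z) '' {x ∈ Ω | t ≤ u x} ⊆
      {x ∈ ((1 : ℝ) / m) • ∑ i, (fun z => (ρ i) z) '' Ω | t ≤ usharp x} := by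
    rintro _ ⟨_, hx, rfl⟩
    obtain ⟨y, hy, rfl⟩ := (Set.mem_fintype_sum _ _).1 hx
    refine ⟨Set.smul_mem_smul_set ((Set.mem_fintype_sum _ _).2
      ⟨y, fun {i} => Set.image_mono (Set.sep_subset _ _) (hy i), rfl⟩), ?_⟩
    rw [husharp]
    obtain ⟨C, hC⟩ := hub
    have hbdd : BddAbove {mval : ℝ | ∃ z : Fin m → EuclideanSpace ℝ (Fin n),
        (∀ i, z i ∈ closure ((fun z => (ρ i) z) '' Ω)) ∧
        ((1 : ℝ) / m) • ∑ i, y i = ∑ i, ((1 : ℝ) / m) • z i ∧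
        mval = (∑ i, ((1 : ℝ) / m) * u ((ρ i).symm (z i)) ^ p) ^ (1 / p)} := by
      refine ⟨C, ?_⟩
      rintro _ ⟨z, -, -, rfl⟩
      exact one_div_mul_sum_rpow_le hm hp (fun i => hun _) (fun i => hC _) ((hun 0).trans (hC 0))
    refine le_trans ?_ (le_csSup hbdd
      ⟨y, fun i => subset_closure (Set.image_mono (Set.sep_subset _ _) (hy i)),
        Finset.smul_sum, rfl⟩)
    refine le_one_div_mul_sum_rpow hm hp ht0 fun i => ?_
    obtain ⟨a, ha, hai⟩ := hy i
    rw [← hai]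
    simpa using ha.2
  exact ⟨hsub, (volume_le_volume_mean_image hm ρ
    (hΩo.measurableSet.inter (measurableSet_le measurable_const hum))).trans (measure_mono hsub)⟩
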